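/- arXiv:1102.4196 — 3 statements merged into one kernel-verified Lean document; each statement's English description precedes it below -/
import Mathlib

section
/- Let j be a negative half-integer. The bilinear form β_j on D⁺_j × D⁻_j determined on basis vectors by β_j(|j,m⟩₊, |j,n⟩₋) = δ_{m,n} is nondegenerate and sl(2,ℂ)-invariant, i.e. β_j(x·u, v) + β_j(u, x·v) = 0 for every x ∈ sl(2,ℂ), u ∈ D⁺_j and v ∈ D⁻_j. -/
/-!
Discrete-series weight modules `D⁺_j` and `D⁻_j` of `sl(2,ℂ)`.

`sl(2,ℂ)` is taken to be Mathlib's Lie algebra of traceless `2×2` complex matrices,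
with basis `J⁰ = diag(1,-1)`, `J⁺ = E₀₁`, `J⁻ = E₁₀`, so that
`[J⁺,J⁻] = J⁰`, `[J⁰,J^±] = ±2 J^±`.  A general element
`x` decomposes as `x = x₀₀·J⁰ + x₀₁·J⁺ + x₁₀·J⁻`, and an action of `sl(2,ℂ)` is
specified by the three operators representing `J⁰`, `J⁺`, `J⁻`.

The underlying space of `D^±_j` is the space `ℕ →₀ ℂ` of finitely supported
functions, with standard basis `ket m = |j,m⟩`.
-/

noncomputable section

abbrev Dspace : Type := ℕ →₀ ℂ

/-- the basis vector `|j,m⟩` -/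
def ket (m : ℕ) : Dspace := Finsupp.single m 1

/-- diagonal operator `ket m ↦ c m • ket m` -/
def diagOp (c : ℕ → ℂ) : Dspace →ₗ[ℂ] Dspace :=
  Finsupp.lsum ℂ fun m => c m • Finsupp.lsingle m

/-- raising operator `ket m ↦ c m • ket (m+1)` -/
def raiseOp (c : ℕ → ℂ) : Dspace →ₗ[ℂ] Dspace :=
  Finsupp.lsum ℂ fun m => c m • Finsupp.lsingle (m + 1)

/-- lowering operator `ket m ↦ c m • ket (m-1)` (with `c 0 = 0` in all uses below) -/
def lowerOp (c : ℕ → ℂ) : Dspace →ₗ[ℂ] Dspace :=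
  Finsupp.lsum ℂ fun m => c m • Finsupp.lsingle (m - 1)

/-- `√((m+1)(m−2j))` -/
def aCoeff (j : ℝ) (m : ℕ) : ℂ := (Real.sqrt ((m + 1) * (m - 2 * j)) : ℝ)

/-- `√(m(m−1−2j))` -/
def bCoeff (j : ℝ) (m : ℕ) : ℂ := (Real.sqrt (m * (m - 1 - 2 * j)) : ℝ)

/-- `J⁰` on `D⁺_j`:  `J⁰|j,m⟩ = 2(−j+m)|j,m⟩` -/
def JzP (j : ℝ) : Dspace →ₗ[ℂ] Dspace := diagOp fun m => 2 * (-(j : ℂ) + m)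

/-- `J⁺` on `D⁺_j`:  `J⁺|j,m⟩ = √((m+1)(m−2j)) |j,m+1⟩` -/
def JpP (j : ℝ) : Dspace →ₗ[ℂ] Dspace := raiseOp fun m => aCoeff j m

/-- `J⁻` on `D⁺_j`:  `J⁻|j,m⟩ = −√(m(m−1−2j)) |j,m−1⟩` -/
def JmP (j : ℝ) : Dspace →ₗ[ℂ] Dspace := lowerOp fun m => -bCoeff j m

/-- `J⁰` on `D⁻_j`:  `J⁰|j,m⟩ = 2(j−m)|j,m⟩` -/
def JzM (j : ℝ) : Dspace →ₗ[ℂ] Dspace := diagOp fun m => 2 * ((j : ℂ) - m)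

/-- `J⁺` on `D⁻_j`:  `J⁺|j,m⟩ = −√(m(m−1−2j)) |j,m−1⟩` -/
def JpM (j : ℝ) : Dspace →ₗ[ℂ] Dspace := lowerOp fun m => -bCoeff j m

/-- `J⁻` on `D⁻_j`:  `J⁻|j,m⟩ = √((m+1)(m−2j)) |j,m+1⟩` -/
def JmM (j : ℝ) : Dspace →ₗ[ℂ] Dspace := raiseOp fun m => aCoeff j m

/-- the Lie algebra `sl(2,ℂ)` -/
abbrev sl2 := LieAlgebra.SpecialLinear.sl (Fin 2) ℂ

/-- the action of a general element `x = x₀₀·J⁰ + x₀₁·J⁺ + x₁₀·J⁻` of `sl(2,ℂ)`,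
given the operators representing the basis `J⁰, J⁺, J⁻`. -/
def actOf (Jz Jp Jm : Dspace →ₗ[ℂ] Dspace) (x : sl2) : Dspace →ₗ[ℂ] Dspace :=
  (x : Matrix (Fin 2) (Fin 2) ℂ) 0 0 • Jz + (x : Matrix (Fin 2) (Fin 2) ℂ) 0 1 • Jp +
    (x : Matrix (Fin 2) (Fin 2) ℂ) 1 0 • Jm

/-- the action of `x ∈ sl(2,ℂ)` on `D⁺_j` -/
def actP (j : ℝ) (x : sl2) : Dspace →ₗ[ℂ] Dspace := actOf (JzP j) (JpP j) (JmP j) x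

/-- the action of `x ∈ sl(2,ℂ)` on `D⁻_j` -/
def actM (j : ℝ) (x : sl2) : Dspace →ₗ[ℂ] Dspace := actOf (JzM j) (JpM j) (JmM j) x

/-- the bilinear pairing `β_j` of `D⁺_j` with `D⁻_j`, `β_j(|j,m⟩₊,|j,n⟩₋) = δ_{m,n}` -/
def betaForm : Dspace →ₗ[ℂ] Dspace →ₗ[ℂ] ℂ :=
  Finsupp.lsum ℂ fun m => LinearMap.toSpanSingleton ℂ (Dspace →ₗ[ℂ] ℂ) (Finsupp.lapply m)

theorem betaForm_single (m : ℕ) (a : ℂ) (v : Dspace) :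
    betaForm (Finsupp.single m a) v = a * v m := by
  simp [betaForm]

theorem betaForm_single_right (n : ℕ) (b : ℂ) (u : Dspace) :
    betaForm u (Finsupp.single n b) = u n * b := by
  induction u using Finsupp.induction_linear with
  | zero => simp
  | add f g hf hg => simp [hf, hg, add_mul]
  | single m a => by_cases h : m = n <;> simp [betaForm_single, Finsupp.single_apply, h, eq_comm]

theorem ab_coeff (j : ℝ) (m : ℕ) : bCoeff j (m + 1) = aCoeff j m := by
  unfold aCoeff bCoeff
  congr 3
  · push_cast; rfl
  · push_cast; ring

theorem b_zero (j : ℝ) : bCoeff j 0 = 0 := by simp [bCoeff]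

theorem diagOp_single (c : ℕ → ℂ) (m : ℕ) (a : ℂ) :
    diagOp c (Finsupp.single m a) = Finsupp.single m (c m * a) := by
  simp [diagOp]

theorem raiseOp_single (c : ℕ → ℂ) (m : ℕ) (a : ℂ) :
    raiseOp c (Finsupp.single m a) = Finsupp.single (m + 1) (c m * a) := by
  simp [raiseOp]

theorem lowerOp_single (c : ℕ → ℂ) (m : ℕ) (a : ℂ) :
    lowerOp c (Finsupp.single m a) = Finsupp.single (m - 1) (c m * a) := by
  simp [lowerOp]

theorem diag_inv (j : ℝ) (m n : ℕ) (a b : ℂ) :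
    betaForm (JzP j (Finsupp.single m a)) (Finsupp.single n b)
      + betaForm (Finsupp.single m a) (JzM j (Finsupp.single n b)) = 0 := by
  simp only [JzP, JzM, diagOp_single, betaForm_single, Finsupp.single_apply]
  split_ifs with h
  · subst h; ring
  · simp

theorem raise_lower (j : ℝ) (m n : ℕ) (a b : ℂ) :
    betaForm (raiseOp (fun m => aCoeff j m) (Finsupp.single m a)) (Finsupp.single n b)
      + betaForm (Finsupp.single m a) (lowerOp (fun m => -bCoeff j m) (Finsupp.single n b)) = 0 := by
  simp only [raiseOp_single, lowerOp_single, betaForm_single, Finsupp.single_apply]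
  rcases n with _ | n
  · simp [b_zero]
  · by_cases h : n = m
    · subst h; simp [ab_coeff]; ring
    · simp [h]

theorem lower_raise (j : ℝ) (m n : ℕ) (a b : ℂ) :
    betaForm (lowerOp (fun m => -bCoeff j m) (Finsupp.single m a)) (Finsupp.single n b)
      + betaForm (Finsupp.single m a) (raiseOp (fun m => aCoeff j m) (Finsupp.single n b)) = 0 := by
  simp only [raiseOp_single, lowerOp_single, betaForm_single, Finsupp.single_apply]
  rcases m with _ | m
  · simp [b_zero]
  · by_cases h : n = m
    · subst h; simp [ab_coeff]; ring
    · simp [h]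

/-- Let `j` be a negative half-integer.  The bilinear form `β_j` on
`D⁺_j × D⁻_j` determined by `β_j(|j,m⟩₊,|j,n⟩₋) = δ_{m,n}` is nondegenerate and
`sl(2,ℂ)`-invariant: `β_j(x·u, v) + β_j(u, x·v) = 0` for every `x ∈ sl(2,ℂ)`,
`u ∈ D⁺_j`, `v ∈ D⁻_j`. -/
theorem statement0 (j : ℝ) (hhalf : ∃ n : ℤ, (n : ℝ) = 2 * j) (hneg : j < 0) :
    (∀ m n : ℕ, betaForm (ket m) (ket n) = if m = n then 1 else 0) ∧
    (∀ u : Dspace, (∀ v : Dspace, betaForm u v = 0) → u = 0) ∧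
    (∀ v : Dspace, (∀ u : Dspace, betaForm u v = 0) → v = 0) ∧
    (∀ (x : sl2) (u v : Dspace), betaForm (actP j x u) v + betaForm u (actM j x v) = 0) := by
  refine ⟨?_, ?_, ?_, ?_⟩
  · intro m n
    simp [ket, betaForm_single, Finsupp.single_apply, eq_comm]
  · intro u h
    ext n
    simpa [betaForm_single_right] using h (Finsupp.single n 1)
  · intro v h
    ext n
    simpa [betaForm_single] using h (Finsupp.single n 1)
  · intro x u v
    induction u using Finsupp.induction_linear with
    | zero => simp
    | add f g hf hg =>
      simp only [map_add, LinearMap.add_apply]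
      linear_combination hf + hg
    | single m a =>
      induction v using Finsupp.induction_linear with
      | zero => simp
      | add f g hf hg =>
        simp only [map_add]
        linear_combination hf + hg
      | single n b =>
        have h1 := diag_inv j m n a b
        have h2 := raise_lower j m n a b
        have h3 := lower_raise j m n a b
        simp only [actP, actM, actOf, JpP, JpM, JmP, JmM, LinearMap.add_apply,
          LinearMap.smul_apply, map_add, map_smul, smul_eq_mul]
        linear_combination (x : Matrix (Fin 2) (Fin 2) ℂ) 0 0 * h1
          + (x : Matrix (Fin 2) (Fin 2) ℂ) 0 1 * h2 + (x : Matrix (Fin 2) (Fin 2) ℂ) 1 0 * h3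
end
end

section
/- Let j be a negative half-integer. Every bilinear form B : D⁺_j × D⁻_j → ℂ satisfying the invariance condition B(x·u, v) + B(u, x·v) = 0 for all x ∈ sl(2,ℂ), u ∈ D⁺_j, v ∈ D⁻_j is a scalar multiple of the form β_j determined by β_j(|j,m⟩₊, |j,n⟩₋) = δ_{m,n}; in particular the space of invariant bilinear pairings of D⁺_j with D⁻_j is one-dimensional. -/
/-!
Discrete-series weight modules `D⁺_j` and `D⁻_j` of `sl(2,ℂ)`.

`sl(2,ℂ)` is taken to be Mathlib's Lie algebra of traceless `2×2` complex matrices,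
with basis `J⁰ = diag(1,-1)`, `J⁺ = E₀₁`, `J⁻ = E₁₀`, so that
`[J⁺,J⁻] = J⁰`, `[J⁰,J^±] = ±2 J^±`.  A general element
`x` decomposes as `x = x₀₀·J⁰ + x₀₁·J⁺ + x₁₀·J⁻`, and an action of `sl(2,ℂ)` is
specified by the three operators representing `J⁰`, `J⁺`, `J⁻`.

The underlying space of `D^±_j` is the space `ℕ →₀ ℂ` of finitely supported
functions, with standard basis `ket m = |j,m⟩`.
-/

noncomputable section

theorem diagOp_ket (c : ℕ → ℂ) (m : ℕ) : diagOp c (ket m) = c m • ket m := by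
  simp [diagOp, ket]

theorem raiseOp_ket (c : ℕ → ℂ) (m : ℕ) : raiseOp c (ket m) = c m • ket (m + 1) := by
  simp [raiseOp, ket]

theorem lowerOp_ket (c : ℕ → ℂ) (m : ℕ) : lowerOp c (ket m) = c m • ket (m - 1) := by
  simp [lowerOp, ket]

theorem betaForm_ket (m n : ℕ) : betaForm (ket m) (ket n) = if m = n then 1 else 0 := by
  simp [betaForm, ket, Finsupp.single_apply, eq_comm]

/-- Let `j` be a negative half-integer.  Every bilinear form
`B : D⁺_j × D⁻_j → ℂ` satisfying the invariance condition
`B(x·u, v) + B(u, x·v) = 0` for all `x ∈ sl(2,ℂ)`, `u ∈ D⁺_j`, `v ∈ D⁻_j` is a scalar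
multiple of the form `β_j` determined by `β_j(|j,m⟩₊,|j,n⟩₋) = δ_{m,n}`; in particular
the space of invariant bilinear pairings of `D⁺_j` with `D⁻_j` is one-dimensional. -/
theorem statement1 (j : ℝ) (hhalf : ∃ n : ℤ, (n : ℝ) = 2 * j) (hneg : j < 0)
    (B : Dspace →ₗ[ℂ] Dspace →ₗ[ℂ] ℂ)
    (hinv : ∀ (x : sl2) (u v : Dspace), B (actP j x u) v + B u (actM j x v) = 0) :
    ∃ c : ℂ, B = c • betaForm := by
  let xz : sl2 := ⟨!![1, 0; 0, -1], by
    change Matrix.trace (!![1, 0; 0, -1] : Matrix (Fin 2) (Fin 2) ℂ) = 0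
    simp [Matrix.trace_fin_two]⟩
  let xp : sl2 := ⟨!![0, 1; 0, 0], by
    change Matrix.trace (!![0, 1; 0, 0] : Matrix (Fin 2) (Fin 2) ℂ) = 0
    simp [Matrix.trace_fin_two]⟩
  have hz : ∀ m n, m ≠ n → B (ket m) (ket n) = 0 := by
    intro m n hmn
    have h := hinv xz (ket m) (ket n)
    simp only [actP, actM, actOf, xz, JzP, JzM] at h
    simp [diagOp_ket] at h
    have h2 : ((m : ℂ) - n) * B (ket m) (ket n) = 0 := by linear_combination h / 2
    rcases mul_eq_zero.mp h2 with h3 | h3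
    · exact absurd (by exact_mod_cast sub_eq_zero.mp h3) hmn
    · exact h3
  have hp : ∀ m, B (ket (m + 1)) (ket (m + 1)) = B (ket m) (ket m) := by
    intro m
    have h := hinv xp (ket m) (ket (m + 1))
    simp only [actP, actM, actOf, xp, JpP, JpM] at h
    simp [raiseOp_ket, lowerOp_ket] at h
    have hab : bCoeff j (m + 1) = aCoeff j m := by
      simp [aCoeff, bCoeff]
    have ha : aCoeff j m ≠ 0 := by
      have : 0 < ((m : ℝ) + 1) * (m - 2 * j) := by
        have : (0 : ℝ) ≤ m := Nat.cast_nonneg m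
        apply mul_pos <;> linarith
      simpa [aCoeff] using (Real.sqrt_pos.mpr this).ne'
    rw [hab] at h
    apply mul_left_cancel₀ ha
    linear_combination h
  have hd : ∀ m, B (ket m) (ket m) = B (ket 0) (ket 0) := by
    intro m
    induction m with
    | zero => rfl
    | succ k ih => rw [hp, ih]
  refine ⟨B (ket 0) (ket 0), ?_⟩
  have key : ∀ m n, B (ket m) (ket n) = B (ket 0) (ket 0) * betaForm (ket m) (ket n) := by
    intro m n
    rw [betaForm_ket]
    split_ifs with h
    · subst h
      rw [hd, mul_one]
    · rw [hz m n h, mul_zero]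
  apply Finsupp.lhom_ext'
  intro m
  apply LinearMap.ext_ring
  apply Finsupp.lhom_ext'
  intro n
  apply LinearMap.ext_ring
  exact key m n
end
end

section
/- Let i and j be negative half-integers (possibly equal). The only element w of the algebraic tensor product D⁺_i ⊗ D⁻_j satisfying (x ⊗ id + id ⊗ x)(w) = 0 for all x ∈ sl(2,ℂ) is w = 0. Equivalently, every sl(2,ℂ)-module homomorphism from the trivial module D₀ to D⁺_i ⊗ D⁻_j is zero. -/
/-!
Discrete-series weight modules `D⁺_j` and `D⁻_j` of `sl(2,ℂ)`.

`sl(2,ℂ)` is taken to be Mathlib's Lie algebra of traceless `2×2` complex matrices,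
with basis `J⁰ = diag(1,-1)`, `J⁺ = E₀₁`, `J⁻ = E₁₀`, so that
`[J⁺,J⁻] = J⁰`, `[J⁰,J^±] = ±2 J^±`.  A general element
`x` decomposes as `x = x₀₀·J⁰ + x₀₁·J⁺ + x₁₀·J⁻`, and an action of `sl(2,ℂ)` is
specified by the three operators representing `J⁰`, `J⁺`, `J⁻`.

The underlying space of `D^±_j` is the space `ℕ →₀ ℂ` of finitely supported
functions, with standard basis `ket m = |j,m⟩`.
-/

noncomputable section

open TensorProduct

/-- shortcut instance (the canonical `Zero` coming from the `AddCommMonoid` structure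
of the tensor product; instance search for `Zero` alone times out here) -/
noncomputable instance : Zero (Dspace ⊗[ℂ] Dspace) := AddMonoid.toZero

theorem raiseOp_apply_succ (c : ℕ → ℂ) (u : Dspace) (m : ℕ) :
    raiseOp c u (m + 1) = c m * u m := by
  induction u using Finsupp.induction_linear with
  | zero => simp
  | add f g hf hg => simp [hf, hg, mul_add]
  | single a b =>
    simp only [raiseOp, Finsupp.lsum_single, LinearMap.smul_apply, Finsupp.lsingle_apply,
      Finsupp.smul_apply, Finsupp.single_apply, smul_eq_mul]
    by_cases h : a = m
    · simp [h]
    · simp [h]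

theorem lowerOp_apply (c : ℕ → ℂ) (hc : c 0 = 0) (u : Dspace) (m : ℕ) :
    lowerOp c u m = c (m + 1) * u (m + 1) := by
  induction u using Finsupp.induction_linear with
  | zero => simp
  | add f g hf hg => simp [hf, hg, mul_add]
  | single a b =>
    simp only [lowerOp, Finsupp.lsum_single, LinearMap.smul_apply, Finsupp.lsingle_apply,
      Finsupp.smul_apply, Finsupp.single_apply, smul_eq_mul]
    rcases a with _ | a
    · simp [hc]
    · by_cases h : a = m
      · simp [h]
      · simp [h]

/-- the coefficients of an element of the tensor product -/
def tcoef : (Dspace ⊗[ℂ] Dspace) ≃ₗ[ℂ] (ℕ × ℕ →₀ ℂ) := finsuppTensorFinsupp' ℂ ℕ ℕ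

theorem tcoef_tmul (u v : Dspace) (m n : ℕ) : tcoef (u ⊗ₜ v) (m, n) = u m * v n := by
  simp [tcoef]

theorem tcoef_raise (c : ℕ → ℂ) (w : Dspace ⊗[ℂ] Dspace) (m n : ℕ) :
    tcoef (TensorProduct.map (raiseOp c) LinearMap.id w) (m + 1, n) = c m * tcoef w (m, n) := by
  induction w using TensorProduct.induction_on with
  | zero => rw [map_zero, map_zero]; simp
  | tmul u v =>
    rw [TensorProduct.map_tmul, tcoef_tmul, tcoef_tmul, raiseOp_apply_succ, LinearMap.id_apply,
      mul_assoc]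
  | add x y hx hy =>
    rw [map_add, map_add, map_add, Finsupp.add_apply, hx, hy, Finsupp.add_apply, mul_add]

theorem tcoef_lower (c : ℕ → ℂ) (hc : c 0 = 0) (w : Dspace ⊗[ℂ] Dspace) (m n : ℕ) :
    tcoef (TensorProduct.map LinearMap.id (lowerOp c) w) (m, n)
      = c (n + 1) * tcoef w (m, n + 1) := by
  induction w using TensorProduct.induction_on with
  | zero => rw [map_zero, map_zero]; simp
  | tmul u v =>
    rw [TensorProduct.map_tmul, tcoef_tmul, tcoef_tmul, lowerOp_apply c hc, LinearMap.id_apply]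
    ring
  | add x y hx hy =>
    rw [map_add, map_add, map_add, Finsupp.add_apply, hx, hy, Finsupp.add_apply, mul_add]

theorem aCoeff_ne_zero (i : ℝ) (hi : i < 0) (m : ℕ) : aCoeff i m ≠ 0 := by
  unfold aCoeff
  have h : (0 : ℝ) < (m + 1) * (m - 2 * i) := by
    have : (0 : ℝ) ≤ m := Nat.cast_nonneg m
    apply mul_pos <;> linarith
  exact_mod_cast (Real.sqrt_pos.mpr h).ne'

/-- the element `J⁺` of `sl(2,ℂ)` -/
def slPlus : sl2 := ⟨!![0, 1; 0, 0], by
  change Matrix.traceLinearMap (Fin 2) ℂ ℂ _ = 0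
  simp [Matrix.trace_fin_two]⟩

theorem actP_plus (i : ℝ) : actP i slPlus = JpP i := by
  simp [actP, actOf, slPlus]

theorem actM_plus (i : ℝ) : actM i slPlus = JpM i := by
  simp [actM, actOf, slPlus]

theorem vanish (f : ℕ × ℕ →₀ ℂ) (h : ∀ m n, f (m + 1, n + 1) = 0 → f (m, n) = 0) : f = 0 := by
  obtain ⟨N, hN⟩ : ∃ N, ∀ p ∈ f.support, p.1 < N := by
    refine ⟨f.support.sup Prod.fst + 1, fun p hp => Nat.lt_succ_of_le ?_⟩
    exact Finset.le_sup (f := Prod.fst) hp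
  have key : ∀ k m n, N ≤ m + k → f (m, n) = 0 := by
    intro k
    induction k with
    | zero =>
      intro m n hm
      by_contra hne
      have := hN (m, n) (Finsupp.mem_support_iff.mpr hne)
      simp at this hm
      omega
    | succ k ih => exact fun m n hm => h m n (ih _ _ (by omega))
  ext ⟨m, n⟩
  exact key N m n (by omega)

/-- Let `i` and `j` be negative half-integers (possibly equal).  The
only element `w` of the algebraic tensor product `D⁺_i ⊗ D⁻_j` satisfying
`(x ⊗ id + id ⊗ x)(w) = 0` for all `x ∈ sl(2,ℂ)` is `w = 0`.  Equivalently, every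
`sl(2,ℂ)`-module homomorphism from the trivial module `D₀` to `D⁺_i ⊗ D⁻_j` is
zero. -/
theorem statement4 (i j : ℝ)
    (hihalf : ∃ n : ℤ, (n : ℝ) = 2 * i) (hineg : i < 0)
    (hjhalf : ∃ n : ℤ, (n : ℝ) = 2 * j) (hjneg : j < 0)
    (w : Dspace ⊗[ℂ] Dspace)
    (hw : ∀ x : sl2,
      TensorProduct.map (actP i x) LinearMap.id w
        + TensorProduct.map LinearMap.id (actM j x) w = 0) :
    w = 0 := by
  have h := hw slPlus
  rw [actP_plus, actM_plus] at h
  apply tcoef.injective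
  rw [map_zero]
  apply vanish
  intro m n hmn
  have h2 := congrArg (fun t => tcoef t (m + 1, n)) h
  simp only [JpP, JpM] at h2
  rw [map_add, Finsupp.add_apply, tcoef_raise, tcoef_lower _ (by simp [bCoeff]), hmn, map_zero,
    mul_zero, add_zero] at h2
  exact (mul_eq_zero.mp h2).resolve_left (aCoeff_ne_zero i hineg m)
end
end
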